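/- Fix κ ∈ [0, 1/2] and r > 0, and for t > 0 define P_κ(r,t) = ((2κ+1)/(π t²)) (4r²/t²)^κ ∫₀^1 s^{κ-1/2}(1-s)^{κ-1/2}(1 + 4(r²/t²)s)^{-κ-3/2} ds. Then lim_{t → ∞} t^{2+2κ} P_κ(r,t) = ((2κ+1)/π) (2r)^{2κ} · Γ(κ + 1/2)² / Γ(2κ + 1). -/

import Mathlib

open Real MeasureTheory intervalIntegral Filter

/-- The explicit on-diagonal partial-wave kernel of the Aharonov–Bohm relativistic
semigroup: `P κ r t = ((2κ+1)/(πt²)) (4r²/t²)^κ ∫₀^1 s^{κ-1/2}(1-s)^{κ-1/2}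
(1+4(r²/t²)s)^{-κ-3/2} ds`. -/
noncomputable def abKernel (κ r t : ℝ) : ℝ :=
  ((2*κ + 1) / (π * t^2)) * (4 * r^2 / t^2) ^ κ *
    ∫ s in (0 : ℝ)..1,
      s ^ (κ - 1/2) * (1 - s) ^ (κ - 1/2) * (1 + 4 * (r^2 / t^2) * s) ^ (-κ - 3/2)

lemma ofReal_rpow_mul_one_sub_rpow {x : ℝ} (hx : x ∈ Set.Icc (0 : ℝ) 1) (u v : ℝ) :
    ((x ^ (u - 1) * (1 - x) ^ (v - 1) : ℝ) : ℂ) =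
      (x : ℂ) ^ ((u : ℂ) - 1) * (1 - (x : ℂ)) ^ ((v : ℂ) - 1) := by
  rw [Complex.ofReal_mul, Complex.ofReal_cpow hx.1, Complex.ofReal_cpow (sub_nonneg.2 hx.2)]
  push_cast
  rfl

lemma intervalIntegrable_rpow_mul_one_sub_rpow {u v : ℝ} (hu : 0 < u) (hv : 0 < v) :
    IntervalIntegrable (fun x : ℝ => x ^ (u - 1) * (1 - x) ^ (v - 1)) volume 0 1 := by
  have h := (Complex.betaIntegral_convergent (u := u) (v := v) (by simpa) (by simpa)).norm
  refine h.congr fun x hx => ?_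
  rw [Set.uIoc_of_le zero_le_one] at hx
  have hx1 : 0 ≤ 1 - x := sub_nonneg.2 hx.2
  rw [← ofReal_rpow_mul_one_sub_rpow ⟨hx.1.le, hx.2⟩, Complex.norm_real, Real.norm_of_nonneg]
  have := hx.1
  positivity

lemma integral_rpow_mul_one_sub_rpow {u v : ℝ} (hu : 0 < u) (hv : 0 < v) :
    ∫ x in (0 : ℝ)..1, x ^ (u - 1) * (1 - x) ^ (v - 1) =
      Real.Gamma u * Real.Gamma v / Real.Gamma (u + v) := by
  have h : Complex.betaIntegral u v =
      ((∫ x in (0 : ℝ)..1, x ^ (u - 1) * (1 - x) ^ (v - 1) : ℝ) : ℂ) := by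
    rw [← intervalIntegral.integral_ofReal, Complex.betaIntegral]
    refine intervalIntegral.integral_congr fun x hx => ?_
    rw [Set.uIcc_of_le zero_le_one] at hx
    exact (ofReal_rpow_mul_one_sub_rpow hx u v).symm
  have hbeta := ProbabilityTheory.beta_eq_betaIntegralReal u v hu hv
  rw [h, Complex.ofReal_re] at hbeta
  exact hbeta.symm

/-- The weight `(1 + c x) ^ p` with `p ≤ 0` disappears from an integral over `[0, 1]` as
`c` decreases to zero. -/
lemma tendsto_integral_mul_one_add_mul_rpow {ι : Type*} {l : Filter ι} [l.IsCountablyGenerated]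
    {f : ℝ → ℝ} (hf : IntervalIntegrable f volume 0 1) {c : ι → ℝ} (hc : Tendsto c l (nhds 0))
    (hc0 : ∀ᶠ i in l, 0 ≤ c i) {p : ℝ} (hp : p ≤ 0) :
    Tendsto (fun i => ∫ x in (0 : ℝ)..1, f x * (1 + c i * x) ^ p) l
      (nhds (∫ x in (0 : ℝ)..1, f x)) := by
  refine intervalIntegral.tendsto_integral_filter_of_dominated_convergence (fun x => ‖f x‖)
    ?_ ?_ hf.norm ?_
  · refine .of_forall fun i => ?_
    have hfm := hf.aestronglyMeasurable
    rw [← Set.uIoc_of_le (zero_le_one' ℝ)] at hfm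
    exact hfm.mul (by fun_prop : Measurable fun x : ℝ => (1 + c i * x) ^ p).aestronglyMeasurable
  · filter_upwards [hc0] with i hi
    refine .of_forall fun x hx => ?_
    rw [Set.uIoc_of_le zero_le_one] at hx
    have hcx : 0 ≤ c i * x := mul_nonneg hi hx.1.le
    rw [norm_mul, Real.norm_of_nonneg (by positivity : 0 ≤ (1 + c i * x) ^ p)]
    exact mul_le_of_le_one_right (norm_nonneg _)
      (Real.rpow_le_one_of_one_le_of_nonpos (by linarith) hp)
  · refine .of_forall fun x _ => ?_
    have hlim : Tendsto (fun i => 1 + c i * x) l (nhds 1) := by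
      simpa using (hc.mul_const x).const_add 1
    simpa using (hlim.rpow_const (p := p) (Or.inl one_ne_zero)).const_mul (f x)

lemma rpow_mul_abKernel {r t : ℝ} (κ : ℝ) (hr : 0 < r) (ht : 0 < t) :
    t ^ (2 + 2*κ) * abKernel κ r t =
      ((2*κ + 1) / π) * (2*r) ^ (2*κ) *
        ∫ s in (0 : ℝ)..1,
          s ^ (κ - 1/2) * (1 - s) ^ (κ - 1/2) * (1 + 4 * (r^2 / t^2) * s) ^ (-κ - 3/2) := by
  have h1 : (4 * r^2 / t^2) ^ κ = (2*r) ^ (2*κ) / t ^ (2*κ) := by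
    rw [show 4 * r^2 / t^2 = (2*r/t) ^ (2 : ℝ) by rw [Real.rpow_two]; ring,
      ← Real.rpow_mul (by positivity), Real.div_rpow (by positivity) ht.le]
  have h2 : t ^ (2 + 2*κ) = t^2 * t ^ (2*κ) := by
    rw [Real.rpow_add ht, Real.rpow_two]
  have h3 : t ^ (2*κ) ≠ 0 := (Real.rpow_pos_of_pos ht _).ne'
  rw [abKernel, h1, h2]
  generalize (∫ s in (0 : ℝ)..1,
    s ^ (κ - 1/2) * (1 - s) ^ (κ - 1/2) * (1 + 4 * (r^2 / t^2) * s) ^ (-κ - 3/2)) = I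
  field_simp

/-- Sharpness of the decay rate `t^{-2-2κ}`: for `κ ∈ [0,1/2]` and `r > 0`,
`t^{2+2κ} P_κ(r,t) → ((2κ+1)/π) (2r)^{2κ} Γ(κ+1/2)²/Γ(2κ+1)` as `t → ∞`. -/
theorem abKernel_sharp_decay (κ r : ℝ) (hκ : κ ∈ Set.Icc (0 : ℝ) (1/2)) (hr : 0 < r) :
    Tendsto (fun t : ℝ => t ^ (2 + 2*κ) * abKernel κ r t) atTop
      (nhds (((2*κ + 1) / π) * (2*r) ^ (2*κ) *
        (Real.Gamma (κ + 1/2) ^ 2 / Real.Gamma (2*κ + 1)))) := by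
  have hpos : 0 < κ + 1/2 := by linarith [hκ.1]
  have hint := intervalIntegrable_rpow_mul_one_sub_rpow hpos hpos
  have hbeta := integral_rpow_mul_one_sub_rpow hpos hpos
  rw [show κ + 1/2 - 1 = κ - 1/2 by ring] at hint hbeta
  rw [show κ + 1/2 + (κ + 1/2) = 2*κ + 1 by ring, ← sq] at hbeta
  have hc : Tendsto (fun t : ℝ => 4 * (r^2 / t^2)) atTop (nhds 0) := by
    simpa using (tendsto_const_nhds.div_atTop (tendsto_pow_atTop two_ne_zero)).const_mul (4 : ℝ)
  have hlim := tendsto_integral_mul_one_add_mul_rpow hint hc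
    (.of_forall fun t => by positivity) (p := -κ - 3/2) (by linarith [hκ.1])
  rw [hbeta] at hlim
  refine (hlim.const_mul (((2*κ + 1) / π) * (2*r) ^ (2*κ))).congr' ?_
  filter_upwards [eventually_gt_atTop 0] with t ht
  exact (rpow_mul_abKernel κ hr ht).symm
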